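/- arXiv:1311.7274 — 2 statements merged into one kernel-verified Lean document; each statement's English description precedes it below -/
import Mathlib

section
/- Let p and q be coprime positive integers with q ≡ 3 (mod 4), let m be an integer, and let φ be an integer with 4p·φ ≡ 1 (mod q). Then G(-p, m, q) = -i·√q · (p|q) · exp(2πi φ m²/q), where (p|q) denotes the Jacobi symbol. -/
/-- The generalized quadratic Gauss sum
`G(a, b, c) = ∑_{l=0}^{c-1} exp(2πi(a l² + b l)/c)`. -/
noncomputable def gaussG (a b : ℤ) (c : ℕ) : ℂ :=
  ∑ l ∈ Finset.range c,
    Complex.exp (2 * (Real.pi : ℂ) * Complex.I *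
      ((a : ℂ) * (l : ℂ) ^ 2 + (b : ℂ) * (l : ℂ)) / (c : ℂ))

lemma norm_cexp_neg_pi_mul_sq (s : ℂ) (n : ℤ) (y : ℝ) :
    ‖Complex.exp (-Real.pi * s * n ^ 2 + 2 * Real.pi * (y * Complex.I) * n)‖ =
      Real.exp (-Real.pi * s.re * n ^ 2) := by
  rw [Complex.norm_exp]
  congr 1
  have : (-Real.pi * s * n ^ 2 + 2 * Real.pi * (y * Complex.I) * n : ℂ) =
      ((-Real.pi * n ^ 2 : ℝ) : ℂ) * s + ((2 * Real.pi * y * n : ℝ) : ℂ) * Complex.I := by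
    push_cast; ring
  rw [this, Complex.add_re, Complex.re_ofReal_mul, Complex.re_ofReal_mul, Complex.I_re]
  ring

lemma summable_exp_neg_pi_mul_int_sq {r : ℝ} (hr : 0 < r) :
    Summable fun n : ℤ ↦ Real.exp (-Real.pi * r * n ^ 2) := by
  have h := ((summable_jacobiTheta₂_term_iff 0 (r * Complex.I)).2 (by simpa using hr)).norm
  refine h.congr fun n ↦ ?_
  rw [norm_jacobiTheta₂_term]
  congr 1
  simp
  ring

lemma tendsto_tsum_exp_neg_quadratic_of_re_atTop {α : Type*} {l : Filter α} {s : α → ℂ}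
    (hs : Filter.Tendsto (fun x ↦ (s x).re) l Filter.atTop) (y : ℝ) :
    Filter.Tendsto (fun x ↦ ∑' n : ℤ, Complex.exp
      (-Real.pi * s x * n ^ 2 + 2 * Real.pi * (y * Complex.I) * n)) l (nhds 1) := by
  have key := tendsto_tsum_of_dominated_convergence (𝓕 := l)
    (f := fun x (n : ℤ) ↦ Complex.exp
      (-Real.pi * s x * n ^ 2 + 2 * Real.pi * (y * Complex.I) * n))
    (g := fun n : ℤ ↦ if n = 0 then (1 : ℂ) else 0)
    (summable_exp_neg_pi_mul_int_sq one_pos) ?_ ?_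
  · simpa using key
  · intro n
    by_cases hn : n = 0
    · simpa [hn] using tendsto_const_nhds
    · simp only [hn, if_false]
      rw [tendsto_zero_iff_norm_tendsto_zero]
      simp_rw [norm_cexp_neg_pi_mul_sq]
      refine Real.tendsto_exp_atBot.comp ?_
      have hc : 0 < Real.pi * (n : ℝ) ^ 2 := by positivity
      refine (Filter.tendsto_neg_atTop_atBot.comp (hs.const_mul_atTop hc)).congr fun x ↦ ?_
      simp only [Function.comp_apply]
      ring
  · filter_upwards [hs.eventually_ge_atTop 1] with x hx n
    rw [norm_cexp_neg_pi_mul_sq]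
    refine Real.exp_le_exp.2 ?_
    have : 0 ≤ Real.pi * (n : ℝ) ^ 2 := by positivity
    nlinarith

lemma tsum_exp_neg_pi_div_mul_sq_arith_prog {s : ℂ} (hs : 0 < s.re) (N : ℕ) [NeZero N] (l : ℕ) :
    ∑' k : ℤ, Complex.exp (-Real.pi / s * (k * N + l) ^ 2) =
      (s / N ^ 2) ^ (1 / 2 : ℂ) * ∑' n : ℤ, Complex.exp (-Real.pi * (s / N ^ 2) * n ^ 2 +
        2 * Real.pi * ((-(l / N) : ℝ) * Complex.I) * n) := by
  have hN : (N : ℂ) ≠ 0 := NeZero.ne _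
  have hs0 : s ≠ 0 := fun h ↦ by simp [h] at hs
  have hre : 0 < (s / (N : ℂ) ^ 2).re := by
    rw [← Nat.cast_pow, Complex.div_natCast_re]
    have := NeZero.pos N
    positivity
  have hne : s / (N : ℂ) ^ 2 ≠ 0 := by positivity
  rw [Complex.tsum_exp_neg_quadratic hre, ← mul_assoc, mul_one_div_cancel, one_mul]
  · refine tsum_congr fun k ↦ ?_
    congr 1
    have : Complex.I * ((-(l / N) : ℝ) * Complex.I) = (l / N : ℂ) := by
      push_cast
      linear_combination (-(l / N : ℂ)) * Complex.I_sq
    rw [this]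
    field_simp
  · simp [Complex.cpow_eq_zero_iff, hne]

lemma summable_mul_exp_neg_pi_div_mul_sq {s : ℂ} (hs : 0 < s.re) {f : ℤ → ℂ}
    (hf : ∀ n, ‖f n‖ ≤ 1) :
    Summable fun n : ℤ ↦ f n * Complex.exp (-Real.pi / s * n ^ 2) := by
  have hs0 : s ≠ 0 := fun h ↦ by simp [h] at hs
  have hre : 0 < s⁻¹.re := by
    rw [Complex.inv_re]
    have := Complex.normSq_pos.2 hs0
    positivity
  refine Summable.of_norm_bounded (summable_exp_neg_pi_mul_int_sq hre) fun n ↦ ?_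
  have h := norm_cexp_neg_pi_mul_sq s⁻¹ n 0
  simp only [Complex.ofReal_zero, zero_mul, mul_zero, add_zero] at h
  rw [norm_mul, div_eq_mul_inv, h]
  exact mul_le_of_le_one_left (Real.exp_pos _).le (hf n)

lemma tsum_periodic_mul_exp_neg_pi_div_mul_sq {s : ℂ} (hs : 0 < s.re) (N : ℕ) [NeZero N]
    {f : ℤ → ℂ} (hf : ∀ n, ‖f n‖ ≤ 1) (hper : Function.Periodic f N) :
    ∑' n : ℤ, f n * Complex.exp (-Real.pi / s * n ^ 2) =
      (s / N ^ 2) ^ (1 / 2 : ℂ) * ∑ l ∈ Finset.range N, f l *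
        ∑' n : ℤ, Complex.exp (-Real.pi * (s / N ^ 2) * n ^ 2 +
          2 * Real.pi * ((-(l / N) : ℝ) * Complex.I) * n) := by
  have hsum := summable_mul_exp_neg_pi_div_mul_sq hs hf
  obtain ⟨e, he⟩ : ∃ e : Fin N × ℤ ≃ ℤ, ∀ l k, e (l, k) = l + k * N :=
    ⟨(Equiv.prodComm _ _).trans (Int.divModEquiv N).symm, fun l k ↦ by simp [add_comm]⟩
  have hprod : Summable fun c : Fin N × ℤ ↦
      f (e c) * Complex.exp (-Real.pi / s * (e c : ℂ) ^ 2) := e.summable_iff.2 hsum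
  rw [← e.tsum_eq, hprod.tsum_prod, tsum_fintype, Finset.mul_sum,
    ← Fin.sum_univ_eq_sum_range (fun l ↦ (s / N ^ 2 : ℂ) ^ (1 / 2 : ℂ) * (f l *
        ∑' n : ℤ, Complex.exp (-Real.pi * (s / N ^ 2) * n ^ 2 +
          2 * Real.pi * ((-(l / N) : ℝ) * Complex.I) * n)))]
  refine Finset.sum_congr rfl fun l _ ↦ ?_
  rw [mul_left_comm, ← tsum_exp_neg_pi_div_mul_sq_arith_prog hs, ← tsum_mul_left]
  refine tsum_congr fun k ↦ ?_
  have hfk : f (l + k * N) = f l := by simpa using hper.int_mul k (l : ℤ)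
  simp only [he, hfk]
  push_cast
  rw [add_comm (l : ℂ)]

lemma tendsto_sum_mul_tsum_exp {α : Type*} {L : Filter α} {s : α → ℂ}
    (hs : Filter.Tendsto (fun x ↦ (s x).re) L Filter.atTop) (N : ℕ) [NeZero N] (f : ℤ → ℂ) :
    Filter.Tendsto (fun x ↦ ∑ l ∈ Finset.range N, f l *
        ∑' n : ℤ, Complex.exp (-Real.pi * (s x / N ^ 2) * n ^ 2 +
          2 * Real.pi * ((-(l / N) : ℝ) * Complex.I) * n)) L
      (nhds (∑ l ∈ Finset.range N, f l)) := by
  refine tendsto_finsetSum _ fun l _ ↦ ?_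
  have h : Filter.Tendsto (fun x ↦ (s x / (N : ℂ) ^ 2).re) L Filter.atTop := by
    have hN : (0 : ℝ) < (N ^ 2 : ℕ) := by
      have := NeZero.pos N
      positivity
    refine (hs.atTop_div_const hN).congr fun x ↦ ?_
    rw [← Nat.cast_pow, Complex.div_natCast_re]
  simpa using (tendsto_tsum_exp_neg_quadratic_of_re_atTop h (-(l / N))).const_mul (f l)

lemma ofReal_mul_cpow {r : ℝ} (hr : 0 < r) {x : ℂ} (hx : x ≠ 0) (c : ℂ) :
    ((r : ℂ) * x) ^ c = (r : ℂ) ^ c * x ^ c := by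
  have hr' : (r : ℂ) ≠ 0 := by exact_mod_cast hr.ne'
  rw [Complex.cpow_def_of_ne_zero (mul_ne_zero hr' hx), Complex.cpow_def_of_ne_zero hr',
    Complex.cpow_def_of_ne_zero hx, Complex.log_ofReal_mul hr hx, ← Complex.exp_add,
    Complex.ofReal_log hr.le, add_mul]

lemma norm_cexp_mul_I_eq_one {z : ℂ} (x : ℝ) (h : z = x * Complex.I) : ‖Complex.exp z‖ = 1 := by
  rw [h, Complex.norm_exp_ofReal_mul_I]

lemma periodic_cexp_two_pi_I_mul_sq_div (q : ℕ) [NeZero q] :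
    Function.Periodic (fun n : ℤ ↦ Complex.exp (2 * Real.pi * Complex.I * n ^ 2 / q)) q := by
  intro n
  have hq : (q : ℂ) ≠ 0 := NeZero.ne _
  refine Complex.exp_eq_exp_iff_exists_int.2 ⟨2 * n + q, ?_⟩
  push_cast
  field_simp
  ring

lemma periodic_cexp_neg_pi_I_mul_sq (q : ℕ) :
    Function.Periodic (fun n : ℤ ↦ Complex.exp (-Real.pi * Complex.I * q * n ^ 2 / 2))
      (2 : ℕ) := by
  intro n
  refine Complex.exp_eq_exp_iff_exists_int.2 ⟨-q * (n + 1), ?_⟩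
  push_cast
  ring

/-- Poisson summation turns the Gauss sum modulo `q` into a sum modulo `2`, once the factors which
depend on the width `S` of the Gaussian weight are balanced. -/
lemma sum_mul_tsum_exp_reciprocity (q : ℕ) [NeZero q] {S : ℝ} (hS : 0 < S) :
    (∑ l ∈ Finset.range q, Complex.exp (2 * Real.pi * Complex.I * (l : ℤ) ^ 2 / q) *
        ∑' n : ℤ, Complex.exp (-Real.pi * (S / q ^ 2) * n ^ 2 +
          2 * Real.pi * ((-(l / q) : ℝ) * Complex.I) * n)) *
      (1 / S - 2 * Complex.I / q : ℂ) ^ (1 / 2 : ℂ) =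
    (1 + Complex.I * q / (2 * S) : ℂ) ^ (1 / 2 : ℂ) *
      ∑ l ∈ Finset.range 2, Complex.exp (-Real.pi * Complex.I * q * (l : ℤ) ^ 2 / 2) *
        ∑' n : ℤ, Complex.exp (-Real.pi * ((4 * S / q ^ 2 + 2 * Complex.I / q) / (2 : ℕ) ^ 2) *
          n ^ 2 + 2 * Real.pi * ((-(l / (2 : ℕ)) : ℝ) * Complex.I) * n) := by
  have hq : (q : ℂ) ≠ 0 := NeZero.ne _
  have hq0 : (0 : ℝ) < q := by exact_mod_cast NeZero.pos q
  have hS0 : (S : ℂ) ≠ 0 := by exact_mod_cast hS.ne'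
  have hs' : 0 < (4 * S / q ^ 2 + 2 * Complex.I / q : ℂ).re := by
    have : (4 * S / q ^ 2 + 2 * Complex.I / q : ℂ) =
        ((4 * S / q ^ 2 : ℝ) : ℂ) + ((2 / q : ℝ) : ℂ) * Complex.I := by push_cast; ring
    rw [this, Complex.add_re, Complex.ofReal_re, Complex.re_ofReal_mul, Complex.I_re]
    have : 0 < 4 * S / (q : ℝ) ^ 2 := by positivity
    linarith
  have ha : 0 < (1 / S - 2 * Complex.I / q : ℂ).re := by
    have : (1 / S - 2 * Complex.I / q : ℂ) =
        ((1 / S : ℝ) : ℂ) + ((-2 / q : ℝ) : ℂ) * Complex.I := by push_cast; ring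
    rw [this, Complex.add_re, Complex.ofReal_re, Complex.re_ofReal_mul, Complex.I_re]
    have : 0 < 1 / S := by positivity
    linarith
  have h1 := tsum_periodic_mul_exp_neg_pi_div_mul_sq (s := (S : ℂ)) (by simpa using hS) q
    (f := fun n : ℤ ↦ Complex.exp (2 * Real.pi * Complex.I * n ^ 2 / q))
    (fun n ↦ (norm_cexp_mul_I_eq_one (2 * Real.pi * n ^ 2 / q) (by push_cast; ring)).le)
    (periodic_cexp_two_pi_I_mul_sq_div q)
  have h2 := tsum_periodic_mul_exp_neg_pi_div_mul_sq hs' 2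
    (f := fun n : ℤ ↦ Complex.exp (-Real.pi * Complex.I * q * n ^ 2 / 2))
    (fun n ↦ (norm_cexp_mul_I_eq_one (-Real.pi * q * n ^ 2 / 2) (by push_cast; ring)).le)
    (periodic_cexp_neg_pi_I_mul_sq q)
  have h3 := Complex.tsum_exp_neg_mul_int_sq ha
  have hs'0 : (4 * S / q ^ 2 + 2 * Complex.I / q : ℂ) ≠ 0 := fun h ↦ by simp [h] at hs'
  have ha0 : (1 / S - 2 * Complex.I / q : ℂ) ≠ 0 := fun h ↦ by
    rw [h, Complex.zero_re] at ha
    exact ha.false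
  have e1 : ∀ n : ℤ, Complex.exp (-Real.pi * (1 / S - 2 * Complex.I / q) * (n : ℂ) ^ 2) =
      Complex.exp (2 * Real.pi * Complex.I * n ^ 2 / q) *
        Complex.exp (-Real.pi / S * n ^ 2) := fun n ↦ by
    rw [← Complex.exp_add]
    congr 1
    ring
  have hinv : 1 / (1 / S - 2 * Complex.I / q : ℂ) =
      Complex.I * q / 2 + 1 / (4 * S / q ^ 2 + 2 * Complex.I / q) := by
    rw [div_add_div _ _ two_ne_zero hs'0, div_eq_div_iff ha0 (mul_ne_zero two_ne_zero hs'0)]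
    field_simp
    ring_nf
    simp only [Complex.I_sq, Complex.I_pow_three]
    ring
  have e2 : ∀ n : ℤ, Complex.exp (-Real.pi / (1 / S - 2 * Complex.I / q) * (n : ℂ) ^ 2) =
      Complex.exp (-Real.pi * Complex.I * q * n ^ 2 / 2) *
        Complex.exp (-Real.pi / (4 * S / q ^ 2 + 2 * Complex.I / q) * n ^ 2) := fun n ↦ by
    rw [← Complex.exp_add]
    congr 1
    linear_combination (-Real.pi * (n : ℂ) ^ 2) * hinv
  simp_rw [e1, e2] at h3
  rw [h1, h2] at h3
  have hr : 0 < S / (q : ℝ) ^ 2 := by positivity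
  have hw0 : (1 + Complex.I * q / (2 * S) : ℂ) ≠ 0 := fun h ↦ by
    refine hs'0 ?_
    field_simp at h ⊢
    linear_combination 2 * h
  have hw : (4 * S / q ^ 2 + 2 * Complex.I / q : ℂ) / (2 : ℕ) ^ 2 =
      ((S / (q : ℝ) ^ 2 : ℝ) : ℂ) * (1 + Complex.I * q / (2 * S)) := by
    push_cast
    field_simp
    ring
  have hr' : ((S / (q : ℝ) ^ 2 : ℝ) : ℂ) ^ (1 / 2 : ℂ) ≠ 0 := by
    rw [Ne, Complex.cpow_eq_zero_iff]
    exact fun h ↦ hr.ne' (by exact_mod_cast h.1)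
  have ha' : (1 / S - 2 * Complex.I / q : ℂ) ^ (1 / 2 : ℂ) ≠ 0 := by
    rw [Ne, Complex.cpow_eq_zero_iff]
    exact fun h ↦ ha0 h.1
  have hpow : ((4 * S / q ^ 2 + 2 * Complex.I / q : ℂ) / (2 : ℕ) ^ 2) ^ (1 / 2 : ℂ) =
      ((S / (q : ℝ) ^ 2 : ℝ) : ℂ) ^ (1 / 2 : ℂ) *
        (1 + Complex.I * q / (2 * S)) ^ (1 / 2 : ℂ) := by
    rw [hw, ofReal_mul_cpow hr hw0]
  have hcast : (S / q ^ 2 : ℂ) = ((S / (q : ℝ) ^ 2 : ℝ) : ℂ) := by push_cast; rfl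
  rw [hpow] at h3
  rw [one_div_mul_eq_div, eq_div_iff ha'] at h3
  refine mul_left_cancel₀ hr' ?_
  rw [← mul_assoc, ← mul_assoc, ← h3, hcast]

lemma sum_cexp_mul_cpow (q : ℕ) [NeZero q] :
    (∑ l ∈ Finset.range q, Complex.exp (2 * Real.pi * Complex.I * (l : ℤ) ^ 2 / q)) *
      (-2 * Complex.I / q : ℂ) ^ (1 / 2 : ℂ) = 1 + (-Complex.I) ^ q := by
  have hq : (q : ℂ) ≠ 0 := NeZero.ne _
  have hq0 : (0 : ℝ) < q := by exact_mod_cast NeZero.pos q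
  have hinv : Filter.Tendsto (fun S : ℝ ↦ (1 / S : ℂ)) Filter.atTop (nhds 0) := by
    have := (Complex.continuous_ofReal.tendsto 0).comp
      (tendsto_inv_atTop_zero : Filter.Tendsto (fun S : ℝ ↦ S⁻¹) _ _)
    simpa [Function.comp_def] using this
  have hA := tendsto_sum_mul_tsum_exp (L := Filter.atTop) (s := fun S : ℝ ↦ (S : ℂ))
    Filter.tendsto_id q
    (fun n : ℤ ↦ Complex.exp (2 * Real.pi * Complex.I * n ^ 2 / q))
  have hB := tendsto_sum_mul_tsum_exp (L := Filter.atTop)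
    (s := fun S : ℝ ↦ (4 * S / q ^ 2 + 2 * Complex.I / q : ℂ)) (by
      have h : Filter.Tendsto (fun S : ℝ ↦ 4 / (q : ℝ) ^ 2 * S) Filter.atTop Filter.atTop :=
        Filter.tendsto_id.const_mul_atTop (by positivity)
      refine h.congr fun S ↦ ?_
      have : (4 * S / q ^ 2 + 2 * Complex.I / q : ℂ) =
          ((4 / q ^ 2 * S : ℝ) : ℂ) + ((2 / q : ℝ) : ℂ) * Complex.I := by push_cast; ring
      rw [this, Complex.add_re, Complex.ofReal_re, Complex.re_ofReal_mul, Complex.I_re]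
      ring) 2
    (fun n : ℤ ↦ Complex.exp (-Real.pi * Complex.I * q * n ^ 2 / 2))
  have ha : Filter.Tendsto (fun S : ℝ ↦ (1 / S - 2 * Complex.I / q : ℂ) ^ (1 / 2 : ℂ))
      Filter.atTop (nhds ((-2 * Complex.I / q : ℂ) ^ (1 / 2 : ℂ))) := by
    have hmem : (-2 * Complex.I / q : ℂ) ∈ Complex.slitPlane := by
      right
      rw [Complex.div_natCast_im]
      simp [hq0.ne']
    refine (continuousAt_cpow_const hmem).tendsto.comp ?_
    have := hinv.sub_const (2 * Complex.I / q)
    rwa [show (0 - 2 * Complex.I / q : ℂ) = -2 * Complex.I / q by ring] at this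
  have hw : Filter.Tendsto (fun S : ℝ ↦ (1 + Complex.I * q / (2 * S) : ℂ) ^ (1 / 2 : ℂ))
      Filter.atTop (nhds 1) := by
    have h1 : nhds (1 : ℂ) = nhds ((1 : ℂ) ^ (1 / 2 : ℂ)) := by rw [Complex.one_cpow]
    rw [h1]
    refine (continuousAt_cpow_const Complex.one_mem_slitPlane).tendsto.comp ?_
    have := (hinv.const_mul (Complex.I * q / 2)).const_add 1
    rw [mul_zero, add_zero] at this
    refine this.congr fun S ↦ ?_
    ring
  have hlim := tendsto_nhds_unique_of_eventuallyEq (hA.mul ha) (hw.mul hB) (by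
    filter_upwards [Filter.eventually_gt_atTop 0] with S hS
    exact sum_mul_tsum_exp_reciprocity q hS)
  rw [hlim, one_mul, Finset.sum_range_succ, Finset.sum_range_one]
  have hexp : (-Real.pi * Complex.I * q * ((1 : ℕ) : ℤ) ^ 2 / 2 : ℂ) =
      q * (-Real.pi / 2 * Complex.I) := by
    push_cast
    ring
  rw [hexp, Complex.exp_nat_mul, Complex.exp_neg_pi_div_two_mul_I]
  simp

lemma sum_cexp_two_pi_I_mul_sq_div (q : ℕ) [NeZero q] :
    ∑ l ∈ Finset.range q, Complex.exp (2 * Real.pi * Complex.I * (l : ℤ) ^ 2 / q) =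
      Real.sqrt q * ((1 + (-Complex.I) ^ q) * (1 + Complex.I) / 2) := by
  have h := sum_cexp_mul_cpow q
  have hq0 : (0 : ℝ) < q := by exact_mod_cast NeZero.pos q
  have hsq : (Real.sqrt q : ℂ) ^ 2 = q := by exact_mod_cast Real.sq_sqrt hq0.le
  have hs0 : (Real.sqrt q : ℂ) ≠ 0 := by exact_mod_cast (Real.sqrt_pos.2 hq0).ne'
  have hroot : (-2 * Complex.I / q : ℂ) ^ (1 / 2 : ℂ) = (1 - Complex.I) / Real.sqrt q := by
    have hre : 0 < ((1 - Complex.I) / Real.sqrt q).re := by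
      rw [Complex.div_ofReal_re]
      have := Real.sqrt_pos.2 hq0
      simpa using this
    rw [← Complex.sq_cpow_two_inv hre, one_div, div_pow, hsq]
    congr 2
    linear_combination -Complex.I_sq
  rw [hroot] at h
  field_simp at h
  linear_combination (1 + Complex.I) / 2 * h + (∑ l ∈ Finset.range q,
    Complex.exp (2 * Real.pi * Complex.I * (l : ℤ) ^ 2 / q)) / 2 * Complex.I_sq

lemma gaussG_eq_sum_stdAddChar (a b : ℤ) (c : ℕ) [NeZero c] :
    gaussG a b c = ∑ x : ZMod c, ZMod.stdAddChar ((a : ZMod c) * x ^ 2 + (b : ZMod c) * x) := by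
  rw [gaussG]
  refine Finset.sum_nbij' (fun l ↦ (l : ZMod c)) ZMod.val (by simp)
    (fun x _ ↦ Finset.mem_range.2 (ZMod.val_lt x))
    (fun l hl ↦ ZMod.val_cast_of_lt (Finset.mem_range.1 hl)) (by simp) fun l _ ↦ ?_
  have : (a : ZMod c) * (l : ZMod c) ^ 2 + (b : ZMod c) * l = ((a * l ^ 2 + b * l : ℤ) : ZMod c) := by
    push_cast; rfl
  rw [this, ZMod.stdAddChar_coe]
  push_cast
  rfl

lemma gaussG_congr_left {a a' : ℤ} {c : ℕ} [NeZero c] (h : a ≡ a' [ZMOD c]) (b : ℤ) :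
    gaussG a b c = gaussG a' b c := by
  rw [gaussG_eq_sum_stdAddChar, gaussG_eq_sum_stdAddChar, (ZMod.intCast_eq_intCast_iff _ _ _).2 h]

lemma gaussG_neg_zero (a : ℤ) (c : ℕ) :
    gaussG (-a) 0 c = (starRingEnd ℂ) (gaussG a 0 c) := by
  rw [gaussG, gaussG, map_sum]
  refine Finset.sum_congr rfl fun l _ ↦ ?_
  rw [← Complex.exp_conj]
  congr 1
  have h2 : (starRingEnd ℂ) 2 = 2 := map_ofNat _ 2
  simp [h2]

lemma gaussG_complete_square {a b φ : ℤ} {c : ℕ} [NeZero c] (h : 4 * a * φ ≡ 1 [ZMOD c]) :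
    gaussG (-a) b c = Complex.exp (2 * Real.pi * Complex.I * φ * b ^ 2 / c) *
      gaussG (-a) 0 c := by
  have h' : (4 * a * φ : ZMod c) = 1 := by
    exact_mod_cast (ZMod.intCast_eq_intCast_iff _ _ c).2 h
  have hexp : Complex.exp (2 * Real.pi * Complex.I * φ * b ^ 2 / c) =
      ZMod.stdAddChar ((φ : ZMod c) * (b : ZMod c) ^ 2) := by
    have : (φ : ZMod c) * (b : ZMod c) ^ 2 = ((φ * b ^ 2 : ℤ) : ZMod c) := by push_cast; rfl
    rw [this, ZMod.stdAddChar_coe]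
    push_cast
    congr 1
    ring
  rw [hexp, gaussG_eq_sum_stdAddChar, gaussG_eq_sum_stdAddChar, Finset.mul_sum,
    ← Equiv.sum_comp (Equiv.addRight (2 * φ * b : ZMod c))]
  refine Finset.sum_congr rfl fun x _ ↦ ?_
  rw [← AddChar.map_add_eq_mul]
  congr 1
  simp only [Equiv.coe_addRight]
  push_cast
  linear_combination (-b * x - φ * b ^ 2 : ZMod c) * h'

/-- Twisted multiplicativity of the quadratic Gauss sum. -/
lemma gaussG_one_mul {a c : ℕ} [NeZero a] [NeZero c] (h : a.Coprime c) :
    gaussG 1 0 (a * c) = gaussG a 0 c * gaussG c 0 a := by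
  have ha : (a : ℂ) ≠ 0 := NeZero.ne _
  have hc : (c : ℂ) ≠ 0 := NeZero.ne _
  let g : ℕ × ℕ → ZMod (a * c) := fun p ↦ ((a * p.1 + c * p.2 : ℤ) : ZMod (a * c))
  have hinj : Set.InjOn g (Finset.range c ×ˢ Finset.range a : Finset (ℕ × ℕ)) := by
    rintro ⟨i, j⟩ hij ⟨i', j'⟩ hij' he
    simp only [Finset.coe_product, Set.mem_prod, Finset.mem_coe, Finset.mem_range] at hij hij'
    have he' := (ZMod.intCast_eq_intCast_iff_dvd_sub _ _ _).1 he
    have hac : IsCoprime (c : ℤ) a := Nat.isCoprime_iff_coprime.2 h.symm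
    push_cast at he'
    have h1 : (c : ℤ) ∣ (i' : ℤ) - i := by
      refine hac.dvd_of_dvd_mul_left ?_
      convert ((dvd_mul_left (c : ℤ) a).trans he').sub (dvd_mul_right (c : ℤ) (j' - j)) using 1
      ring
    have h2 : (a : ℤ) ∣ (j' : ℤ) - j := by
      refine hac.symm.dvd_of_dvd_mul_left ?_
      convert ((dvd_mul_right (a : ℤ) c).trans he').sub (dvd_mul_right (a : ℤ) (i' - i)) using 1
      ring
    have h3 := Int.eq_zero_of_abs_lt_dvd h1 (by rw [abs_lt]; omega)
    have h4 := Int.eq_zero_of_abs_lt_dvd h2 (by rw [abs_lt]; omega)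
    ext <;> simp only <;> omega
  have himg : (Finset.range c ×ˢ Finset.range a).image g = Finset.univ := by
    refine Finset.eq_univ_of_card _ ?_
    rw [Finset.card_image_of_injOn hinj, Finset.card_product, Finset.card_range,
      Finset.card_range, ZMod.card, mul_comm]
  rw [gaussG_eq_sum_stdAddChar, gaussG, gaussG, Finset.sum_mul_sum, ← Finset.sum_product',
    ← himg, Finset.sum_image hinj]
  refine Finset.sum_congr rfl fun ⟨i, j⟩ _ ↦ ?_
  have : ((1 : ℤ) : ZMod (a * c)) * g (i, j) ^ 2 + ((0 : ℤ) : ZMod (a * c)) * g (i, j) =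
      (((a * i + c * j) ^ 2 : ℤ) : ZMod (a * c)) := by
    simp only [g]
    push_cast
    ring
  rw [this, ZMod.stdAddChar_coe, ← Complex.exp_add]
  refine Complex.exp_eq_exp_iff_exists_int.2 ⟨2 * i * j, ?_⟩
  push_cast
  field_simp
  ring

/-- The value of `(1 + (-i)^n)(1 + i)/2` is the sign of the quadratic Gauss sum modulo `n`. -/
lemma gauss_sign_of_one_mod_four {n : ℕ} (h : n % 4 = 1) :
    (1 + (-Complex.I) ^ n) * (1 + Complex.I) / 2 = 1 := by
  have h4 : (-Complex.I) ^ 4 = 1 := by rw [neg_pow, Complex.I_pow_four]; norm_num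
  rw [← Nat.div_add_mod n 4, h, pow_add, pow_mul, h4, one_pow]
  linear_combination -Complex.I_sq / 2

lemma gauss_sign_of_three_mod_four {n : ℕ} (h : n % 4 = 3) :
    (1 + (-Complex.I) ^ n) * (1 + Complex.I) / 2 = Complex.I := by
  have h4 : (-Complex.I) ^ 4 = 1 := by rw [neg_pow, Complex.I_pow_four]; norm_num
  rw [← Nat.div_add_mod n 4, h, pow_add, pow_mul, h4, one_pow]
  linear_combination (1 - Complex.I ^ 2 - Complex.I) / 2 * Complex.I_sq

lemma gaussG_one_zero (q : ℕ) [NeZero q] :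
    gaussG 1 0 q = Real.sqrt q * ((1 + (-Complex.I) ^ q) * (1 + Complex.I) / 2) := by
  rw [← sum_cexp_two_pi_I_mul_sq_div, gaussG]
  refine Finset.sum_congr rfl fun l _ ↦ ?_
  push_cast
  congr 1
  ring

lemma gauss_sign_mul_of_reciprocity {a c : ℕ} (ha : Odd a) (hc : Odd c) (h : a.Coprime c) :
    (1 + (-Complex.I) ^ (a * c)) * (1 + Complex.I) / 2 =
      (jacobiSym a c * ((1 + (-Complex.I) ^ c) * (1 + Complex.I) / 2)) *
        (jacobiSym c a * ((1 + (-Complex.I) ^ a) * (1 + Complex.I) / 2)) := by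
  have hsq : (jacobiSym c a : ℂ) ^ 2 = 1 := by
    exact_mod_cast jacobiSym.sq_one (b := a) (a := c) (by simpa using h.symm)
  have hmod := Nat.mul_mod a c 4
  rcases Nat.odd_mod_four_iff.1 (Nat.odd_iff.1 ha) with ha4 | ha4 <;>
    rcases Nat.odd_mod_four_iff.1 (Nat.odd_iff.1 hc) with hc4 | hc4 <;>
    simp only [ha4, hc4, Nat.reduceMul, Nat.reduceMod] at hmod
  · rw [gauss_sign_of_one_mod_four hmod, gauss_sign_of_one_mod_four ha4,
      gauss_sign_of_one_mod_four hc4, jacobiSym.quadratic_reciprocity_one_mod_four ha4 hc]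
    linear_combination -hsq
  · rw [gauss_sign_of_three_mod_four hmod, gauss_sign_of_one_mod_four ha4,
      gauss_sign_of_three_mod_four hc4, jacobiSym.quadratic_reciprocity_one_mod_four ha4 hc]
    linear_combination -Complex.I * hsq
  · rw [gauss_sign_of_three_mod_four hmod, gauss_sign_of_three_mod_four ha4,
      gauss_sign_of_one_mod_four hc4, jacobiSym.quadratic_reciprocity_one_mod_four' ha hc4]
    linear_combination -Complex.I * hsq
  · rw [gauss_sign_of_one_mod_four hmod, gauss_sign_of_three_mod_four ha4,
      gauss_sign_of_three_mod_four hc4, jacobiSym.quadratic_reciprocity_three_mod_four ha4 hc4]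
    push_cast
    linear_combination -hsq + (jacobiSym c a : ℂ) ^ 2 * Complex.I_sq

lemma gaussG_neg_eq_of_eq {a : ℤ} {q : ℕ} (hq : Odd q)
    (h : gaussG a 0 q = Real.sqrt q *
      (jacobiSym a q * ((1 + (-Complex.I) ^ q) * (1 + Complex.I) / 2))) :
    gaussG (-a) 0 q = Real.sqrt q *
      (jacobiSym (-a) q * ((1 + (-Complex.I) ^ q) * (1 + Complex.I) / 2)) := by
  rw [gaussG_neg_zero, h, jacobiSym.neg _ hq]
  rcases Nat.odd_mod_four_iff.1 (Nat.odd_iff.1 hq) with hq4 | hq4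
  · rw [gauss_sign_of_one_mod_four hq4, ZMod.χ₄_nat_one_mod_four hq4]
    simp
  · rw [gauss_sign_of_three_mod_four hq4, ZMod.χ₄_nat_three_mod_four hq4]
    simp

theorem gaussG_zero_of_odd (q : ℕ) (hq : Odd q) (a : ℤ) (h : IsCoprime a q) :
    gaussG a 0 q = Real.sqrt q *
      (jacobiSym a q * ((1 + (-Complex.I) ^ q) * (1 + Complex.I) / 2)) := by
  induction q using Nat.strong_induction_on generalizing a with
  | _ q ih =>
  have : NeZero q := ⟨hq.pos.ne'⟩
  rcases eq_or_ne q 1 with rfl | hq1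
  · rw [gauss_sign_of_one_mod_four (by norm_num)]
    simp [gaussG]
  have hodd : ∀ b : ℕ, Odd b → b < q → b.Coprime q → gaussG b 0 q = Real.sqrt q *
      (jacobiSym b q * ((1 + (-Complex.I) ^ q) * (1 + Complex.I) / 2)) := by
    intro b hb hbq hcop
    have : NeZero b := ⟨hb.pos.ne'⟩
    have hqb := ih b hbq hb q (Nat.isCoprime_iff_coprime.2 hcop.symm)
    have hmul := gaussG_one_mul hcop
    rw [gaussG_one_zero, gauss_sign_mul_of_reciprocity hb hq hcop, hqb, Nat.cast_mul,
      Real.sqrt_mul (Nat.cast_nonneg b), Complex.ofReal_mul] at hmul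
    have hsb : (Real.sqrt b : ℂ) ≠ 0 := by
      exact_mod_cast (Real.sqrt_pos.2 (Nat.cast_pos.2 hb.pos)).ne'
    have hJ : (jacobiSym q b : ℂ) ≠ 0 := by
      exact_mod_cast jacobiSym.ne_zero (by simpa using hcop.symm)
    have hsign : (1 + (-Complex.I) ^ b) * (1 + Complex.I) / 2 ≠ 0 := by
      rcases Nat.odd_mod_four_iff.1 (Nat.odd_iff.1 hb) with hb4 | hb4
      · rw [gauss_sign_of_one_mod_four hb4]
        exact one_ne_zero
      · rw [gauss_sign_of_three_mod_four hb4]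
        exact Complex.I_ne_zero
    refine mul_right_cancel₀ (mul_ne_zero hsb (mul_ne_zero hJ hsign)) ?_
    rw [← hmul]
    ring
  obtain ⟨r, hr⟩ := Int.eq_ofNat_of_zero_le (Int.emod_nonneg a (by exact_mod_cast NeZero.ne q :
    (q : ℤ) ≠ 0))
  have hrq : r < q := by
    have := Int.emod_lt_of_pos a (by exact_mod_cast hq.pos : (0 : ℤ) < q)
    omega
  have har : a ≡ r [ZMOD q] := by
    rw [← hr]
    exact (Int.mod_modEq a q).symm
  have hcop : r.Coprime q := by
    rw [← Nat.isCoprime_iff_coprime, ← hr]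
    have := Int.emod_add_mul_ediv a q
    have h2 : a % q = a + q * (-(a / q)) := by linarith
    rw [h2]
    exact h.add_mul_left_left _
  rw [gaussG_congr_left har, jacobiSym.mod_left' har]
  rcases Nat.even_or_odd r with hre | hro
  · have hr0 : r ≠ 0 := by
      rintro rfl
      exact hq1 (by simpa using hcop)
    have hsub := hodd (q - r) (Nat.Odd.sub_even hrq.le hq hre) (by omega)
      ((Nat.coprime_self_sub_left hrq.le).2 hcop)
    have hmod : (r : ℤ) ≡ -((q - r : ℕ) : ℤ) [ZMOD q] := by
      refine (Int.modEq_iff_dvd.2 ⟨-1, ?_⟩)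
      push_cast [hrq.le]
      ring
    rw [gaussG_congr_left hmod, jacobiSym.mod_left' hmod]
    exact gaussG_neg_eq_of_eq hq hsub
  · exact hodd r hro hrq hcop

theorem stmt_2 (p q : ℕ) (hp : 0 < p) (hq : 0 < q) (hpq : Nat.Coprime p q)
    (hq4 : q % 4 = 3) (m φ : ℤ) (hφ : 4 * (p : ℤ) * φ ≡ 1 [ZMOD (q : ℤ)]) :
    gaussG (-(p : ℤ)) m q =
      -Complex.I * (Real.sqrt q : ℂ) * (jacobiSym (p : ℤ) q : ℂ) *
        Complex.exp (2 * (Real.pi : ℂ) * Complex.I * (φ : ℂ) * (m : ℂ) ^ 2 / (q : ℂ)) := by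
  have : NeZero q := ⟨hq.ne'⟩
  have hodd : Odd q := Nat.odd_iff.2 (by omega)
  have hcop : IsCoprime (-(p : ℤ)) q := (Nat.isCoprime_iff_coprime.2 hpq).neg_left
  rw [gaussG_complete_square hφ, gaussG_zero_of_odd q hodd _ hcop, jacobiSym.neg _ hodd,
    gauss_sign_of_three_mod_four hq4, ZMod.χ₄_nat_three_mod_four hq4]
  push_cast
  ring
end

section
/- Let p and q be coprime positive integers with q ≡ 2 (mod 4), and let m be an odd integer. Then G(-p, m, q) = 2·G(-2p, m, q/2). -/
/-- The sum of a `k`-periodic sequence over `k` consecutive indices does not depend on the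
starting point. -/
theorem sum_range_add_of_periodic {M : Type*} [AddCommMonoid M] {g : ℕ → M} {k : ℕ}
    (hg : Function.Periodic g k) (j : ℕ) :
    ∑ l ∈ Finset.range k, g (l + j) = ∑ l ∈ Finset.range k, g l := by
  induction j with
  | zero => rfl
  | succ j ih =>
    rw [← ih]
    cases k with
    | zero => rfl
    | succ n =>
      rw [Finset.sum_range_succ, Finset.sum_range_succ' (fun l => g (l + j))]
      congr 1
      · exact Finset.sum_congr rfl fun l _ => by congr 1; ring
      · rw [← hg (0 + j)]
        congr 1
        ring

theorem sum_range_two_mul {M : Type*} [AddCommMonoid M] (f : ℕ → M) (k : ℕ) :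
    ∑ l ∈ Finset.range (2 * k), f l =
      ∑ l ∈ Finset.range k, f (2 * l) + ∑ l ∈ Finset.range k, f (2 * l + 1) := by
  rw [← Finset.sum_add_distrib]
  induction k with
  | zero => rfl
  | succ n ih =>
    rw [Finset.sum_range_succ, ← ih, mul_add, mul_one, Finset.sum_range_succ,
      Finset.sum_range_succ, add_assoc]

/-- For odd `k`, the sum of a `k`-periodic sequence over `2 * k` consecutive indices is twice
its sum over the even ones. -/
theorem sum_range_two_mul_of_periodic {M : Type*} [AddCommMonoid M] {f : ℕ → M} {k : ℕ}
    (hk : Odd k) (hf : Function.Periodic f k) :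
    ∑ l ∈ Finset.range (2 * k), f l = 2 • ∑ l ∈ Finset.range k, f (2 * l) := by
  obtain ⟨n, rfl⟩ := hk
  have hg : Function.Periodic (fun l => f (2 * l)) (2 * n + 1) := fun l => by
    have h := hf.nat_mul 2 (2 * l)
    simpa [mul_add] using h
  rw [sum_range_two_mul, two_nsmul]
  congr 1
  rw [← sum_range_add_of_periodic hg (n + 1)]
  refine Finset.sum_congr rfl fun l _ => ?_
  rw [← hf (2 * l + 1)]
  congr 1
  ring

/-- If `a * k + b` is even, the summand of `G(a, b, 2k)` is periodic with period `k`. -/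
theorem periodic_gaussG_summand {a b : ℤ} {k : ℕ} (h : Even (a * k + b)) :
    Function.Periodic (fun l : ℕ => Complex.exp (2 * (Real.pi : ℂ) * Complex.I *
      ((a : ℂ) * (l : ℂ) ^ 2 + (b : ℂ) * (l : ℂ)) / ((2 * k : ℕ) : ℂ))) k := by
  intro l
  obtain ⟨r, hr⟩ := h
  rcases eq_or_ne k 0 with rfl | hk
  · rfl
  have hk' : (k : ℂ) ≠ 0 := Nat.cast_ne_zero.mpr hk
  have hr' : (a : ℂ) * k + b = r + r := by exact_mod_cast hr
  refine Complex.exp_eq_exp_iff_exists_int.mpr ⟨a * l + r, ?_⟩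
  push_cast
  field_simp
  linear_combination (k : ℂ) * hr'

theorem stmt_4 (p q : ℕ) (hp : 0 < p) (hq : 0 < q) (hpq : Nat.Coprime p q)
    (hq4 : q % 4 = 2) (m : ℤ) (hm : Odd m) :
    gaussG (-(p : ℤ)) m q = 2 * gaussG (-(2 * p : ℤ)) m (q / 2) := by
  obtain ⟨k, rfl⟩ : ∃ k, q = 2 * k := ⟨q / 2, by lia⟩
  have hk : Odd k := Nat.odd_iff.mpr (by lia)
  have hk' : (k : ℂ) ≠ 0 := Nat.cast_ne_zero.mpr (by lia)
  have hpo : Odd p := Nat.coprime_two_right.mp hpq.coprime_mul_right_right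
  have hev : Even (-(p : ℤ) * k + m) :=
    (((Int.odd_coe_nat p).mpr hpo).neg.mul ((Int.odd_coe_nat k).mpr hk)).add_odd hm
  rw [gaussG, sum_range_two_mul_of_periodic hk (periodic_gaussG_summand hev), gaussG,
    Nat.mul_div_cancel_left k two_pos, nsmul_eq_mul, Nat.cast_ofNat]
  congr 1
  refine Finset.sum_congr rfl fun l _ => congrArg Complex.exp ?_
  push_cast
  field_simp
end
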